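/- Let a simple hexagon (encoded as in the context) satisfy ℓ₀ = ℓ₃, ℓ₁ = ℓ₄ and ℓ₂ = ℓ₅, and suppose that edges 0 and 3 are parallel as opposite sides. Then A₀ + A₂ + A₄ = 2π or A₀ + A₄ + A₅ = 2π. -/

import Mathlib

/-- The direction angle of edge `k`: `φₖ = k·π − (A₁ + ⋯ + Aₖ)` (so `φ₀ = 0`). -/
noncomputable def hexPhi (A : Fin 6 → ℝ) (k : Fin 6) : ℝ :=
  (k : ℕ) * Real.pi -
    ∑ j ∈ Finset.univ.filter (fun j : Fin 6 => 1 ≤ (j : ℕ) ∧ (j : ℕ) ≤ (k : ℕ)), A j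

/-- The closure equation `∑ₖ ℓₖ·exp(I·φₖ) = 0`. -/
def HexClosure (ℓ A : Fin 6 → ℝ) : Prop :=
  ∑ k : Fin 6, (ℓ k : ℂ) * Complex.exp (Complex.I * (hexPhi A k : ℂ)) = 0

/-- The vertices `P_m = ∑_{k<m} ℓₖ·exp(I·φₖ)`. -/
noncomputable def hexVertex (ℓ A : Fin 6 → ℝ) (m : Fin 6) : ℂ :=
  ∑ k ∈ Finset.univ.filter (fun k : Fin 6 => (k : ℕ) < (m : ℕ)),
    (ℓ k : ℂ) * Complex.exp (Complex.I * (hexPhi A k : ℂ))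

/-- Edge `k`: the closed segment from `P_k` to `P_{k+1}` (indices mod 6). -/
noncomputable def hexEdge (ℓ A : Fin 6 → ℝ) (k : Fin 6) : Set ℂ :=
  segment ℝ (hexVertex ℓ A k) (hexVertex ℓ A (k + 1))

/-- Simplicity: non-adjacent edges are disjoint, and adjacent edges meet only in
their common endpoint. -/
def HexSimple (ℓ A : Fin 6 → ℝ) : Prop :=
  (∀ j k : Fin 6, j ≠ k → k ≠ j + 1 → j ≠ k + 1 →
    Disjoint (hexEdge ℓ A j) (hexEdge ℓ A k)) ∧
  (∀ k : Fin 6, hexEdge ℓ A k ∩ hexEdge ℓ A (k + 1) = {hexVertex ℓ A (k + 1)})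

/-- Edges `k` and `k+3` are parallel as opposite sides: `exp(I·φₖ) = −exp(I·φ_{k+3})`. -/
def HexParallelOpp (A : Fin 6 → ℝ) (k : Fin 6) : Prop :=
  Complex.exp (Complex.I * (hexPhi A k : ℂ)) =
    - Complex.exp (Complex.I * (hexPhi A (k + 3) : ℂ))

theorem hexPhi_zero (A : Fin 6 → ℝ) : hexPhi A 0 = 0 := by
  simp [hexPhi, Finset.sum_filter, Fin.sum_univ_succ]

theorem hexPhi_three (A : Fin 6 → ℝ) : hexPhi A 3 = 3 * Real.pi - (A 1 + A 2 + A 3) := by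
  have hs : Finset.univ.filter (fun j : Fin 6 => 1 ≤ (j : ℕ) ∧ (j : ℕ) ≤ ((3 : Fin 6) : ℕ))
      = {1, 2, 3} := by decide
  rw [hexPhi, hs, Finset.sum_insert (by decide), Finset.sum_insert (by decide),
    Finset.sum_singleton]
  norm_num [add_assoc]

/-- If edges `0` and `3` are parallel as opposite sides, the angles between them sum to a
multiple of `2π`. -/
theorem HexParallelOpp.exists_angle_sum_eq {A : Fin 6 → ℝ} (h : HexParallelOpp A 0) :
    ∃ n : ℤ, A 1 + A 2 + A 3 = n * (2 * Real.pi) := by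
  rw [HexParallelOpp, zero_add, hexPhi_zero, hexPhi_three] at h
  have hre := congrArg Complex.re h
  rw [mul_comm Complex.I, mul_comm Complex.I, Complex.neg_re, Complex.exp_ofReal_mul_I_re,
    Complex.exp_ofReal_mul_I_re, Real.cos_zero,
    show 3 * Real.pi - (A 1 + A 2 + A 3) = Real.pi - (A 1 + A 2 + A 3) + 2 * Real.pi by ring,
    Real.cos_add_two_pi, Real.cos_pi_sub, neg_neg] at hre
  obtain ⟨n, hn⟩ := (Real.cos_eq_one_iff _).1 hre.symm
  exact ⟨n, hn.symm⟩

theorem stmt2 (ℓ A : Fin 6 → ℝ)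
    (hlen : ∀ k, 0 < ℓ k)
    (hang_pos : ∀ i, 0 < A i) (hang_lt : ∀ i, A i < 2 * Real.pi)
    (hang_sum : A 0 + A 1 + A 2 + A 3 + A 4 + A 5 = 4 * Real.pi)
    (hclose : HexClosure ℓ A)
    (hsimple : HexSimple ℓ A)
    (h03 : ℓ 0 = ℓ 3) (h14 : ℓ 1 = ℓ 4) (h25 : ℓ 2 = ℓ 5)
    (hpar : HexParallelOpp A 0) :
    A 0 + A 2 + A 4 = 2 * Real.pi ∨ A 0 + A 4 + A 5 = 2 * Real.pi := by
  right
  obtain ⟨n, hn⟩ := hpar.exists_angle_sum_eq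
  have hpi := Real.pi_pos
  have hn_pos : (0 : ℝ) < n := by
    by_contra! hle
    nlinarith [hang_pos 1, hang_pos 2, hang_pos 3]
  have hn_lt : (n : ℝ) < 2 := by
    by_contra! hge
    nlinarith [hang_pos 0, hang_pos 4, hang_pos 5]
  have hn_one : n = 1 := by
    have h0 : 0 < n := by exact_mod_cast hn_pos
    have h2 : n < 2 := by exact_mod_cast hn_lt
    omega
  rw [hn_one, Int.cast_one] at hn
  linarith
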